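/- The sets {123, 3142} and {132, 3124} are forest-Wilf equivalent; that is, for every n ≥ 0 the number of rooted labeled forests on [n] avoiding both patterns 123 and 3142 equals the number of rooted labeled forests on [n] avoiding both patterns 132 and 3124. -/

import Mathlib

/-- A rooted labeled forest on `[n]`: vertices are identified with their labels in `Fin n`
(`i : Fin n` representing the label `i+1`), each vertex has an optional parent, and the
parent relation is acyclic. Components are rooted at the vertices with no parent, and
children are unordered since only the parent function is recorded. -/
structure RForest (n : ℕ) where
  parent : Fin n → Option (Fin n)
  acyclic : ∀ v : Fin n, ¬ Relation.TransGen (fun a b => parent b = some a) v v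

namespace RForest

variable {n : ℕ}

/-- `u` is a strict ancestor of `v`. -/
def SAnc (F : RForest n) (u v : Fin n) : Prop :=
  Relation.TransGen (fun a b => F.parent b = some a) u v

/-- `u` is an ancestor of `v` (possibly `u = v`). -/
def Anc (F : RForest n) (u v : Fin n) : Prop :=
  F.SAnc u v ∨ u = v

/-- `F` is a tree: it has exactly one root, i.e. exactly one component. -/
def IsTree (F : RForest n) : Prop :=
  ∃! r : Fin n, F.parent r = none

end RForest

/-- A pattern of length `k` is a permutation of `[k]` (presented 0-indexed on `Fin k`). -/
abbrev Pattern (k : ℕ) := Equiv.Perm (Fin k)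

/-- The complement of a pattern: `π̄(i) = k + 1 - π(i)` in 1-indexed terms. -/
def Pattern.compl {k : ℕ} (π : Pattern k) : Pattern k :=
  π.trans ⟨Fin.rev, Fin.rev, Fin.rev_rev, Fin.rev_rev⟩

/-- `F` contains a (classical) instance of the pattern `π`: vertices `v 0, …, v (k-1)`,
each a strict ancestor of the next, whose labels are in the same relative order as `π`. -/
def ContainsPat {n k : ℕ} (F : RForest n) (π : Pattern k) : Prop :=
  ∃ v : Fin k → Fin n,
    (∀ i j : Fin k, i < j → F.SAnc (v i) (v j)) ∧
    (∀ i j : Fin k, v i < v j ↔ π i < π j)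

/-- `v` is a consecutive instance of `π` in `F`: a downward path (each vertex the parent of
the next) whose labels are in the same relative order as `π`. -/
def IsConsInstance {n k : ℕ} (F : RForest n) (π : Pattern k) (v : Fin k → Fin n) : Prop :=
  (∀ i j : Fin k, (j : ℕ) = (i : ℕ) + 1 → F.parent (v j) = some (v i)) ∧
  (∀ i j : Fin k, v i < v j ↔ π i < π j)

/-- `F` contains a consecutive instance of `π`. -/
def CContainsPat {n k : ℕ} (F : RForest n) (π : Pattern k) : Prop :=
  ∃ v, IsConsInstance F π v

/-- `F` avoids every pattern in the set `S` (of patterns of arbitrary lengths). -/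
def AvoidsSet {n : ℕ} (F : RForest n) (S : Set ((k : ℕ) × Pattern k)) : Prop :=
  ∀ p ∈ S, ¬ ContainsPat F p.2

/-- `f_n(S)`: the number of rooted labeled forests on `[n]` avoiding `S`. -/
noncomputable def fCount (S : Set ((k : ℕ) × Pattern k)) (n : ℕ) : ℕ :=
  Nat.card {F : RForest n // AvoidsSet F S}

/-- `t_n(S)`: the number of rooted labeled trees on `[n]` avoiding `S`. -/
noncomputable def tCount (S : Set ((k : ℕ) × Pattern k)) (n : ℕ) : ℕ :=
  Nat.card {F : RForest n // F.IsTree ∧ AvoidsSet F S}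

/-- The number of rooted labeled forests on `[n]` consecutively avoiding `π`. -/
noncomputable def cCount {k : ℕ} (π : Pattern k) (n : ℕ) : ℕ :=
  Nat.card {F : RForest n // ¬ CContainsPat F π}

/-- c-forest-Wilf equivalence of two patterns. -/
def CForestWilfEquiv {k k' : ℕ} (π : Pattern k) (π' : Pattern k') : Prop :=
  ∀ n : ℕ, cCount π n = cCount π' n

def p123 : Pattern 3 := 1
def p132 : Pattern 3 := ⟨![0, 2, 1], ![0, 2, 1], by intro x; fin_cases x <;> rfl, by intro x; fin_cases x <;> rfl⟩
def p213 : Pattern 3 := ⟨![1, 0, 2], ![1, 0, 2], by intro x; fin_cases x <;> rfl, by intro x; fin_cases x <;> rfl⟩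
def p231 : Pattern 3 := ⟨![1, 2, 0], ![2, 0, 1], by intro x; fin_cases x <;> rfl, by intro x; fin_cases x <;> rfl⟩
def p312 : Pattern 3 := ⟨![2, 0, 1], ![1, 2, 0], by intro x; fin_cases x <;> rfl, by intro x; fin_cases x <;> rfl⟩
def p321 : Pattern 3 := ⟨![2, 1, 0], ![2, 1, 0], by intro x; fin_cases x <;> rfl, by intro x; fin_cases x <;> rfl⟩
def p2413 : Pattern 4 := ⟨![1, 3, 0, 2], ![2, 0, 3, 1], by intro x; fin_cases x <;> rfl, by intro x; fin_cases x <;> rfl⟩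
def p2314 : Pattern 4 := ⟨![1, 2, 0, 3], ![2, 0, 1, 3], by intro x; fin_cases x <;> rfl, by intro x; fin_cases x <;> rfl⟩
def p3142 : Pattern 4 := ⟨![2, 0, 3, 1], ![1, 3, 0, 2], by intro x; fin_cases x <;> rfl, by intro x; fin_cases x <;> rfl⟩
def p3124 : Pattern 4 := ⟨![2, 0, 1, 3], ![1, 2, 0, 3], by intro x; fin_cases x <;> rfl, by intro x; fin_cases x <;> rfl⟩

/-! ### Reversal of a finite set -/

/-- The order-reversing involution of a finite set `s`, extended by the identity. -/
noncomputable def Finset.revOn {α : Type*} [LinearOrder α] (s : Finset α) (v : α) : α :=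
  if h : v ∈ s then s.orderIsoOfFin rfl ((s.orderIsoOfFin rfl).symm ⟨v, h⟩).rev else v

section RevOn

variable {α : Type*} [LinearOrder α] {s : Finset α} {v w : α}

theorem Finset.revOn_of_notMem (h : v ∉ s) : s.revOn v = v := by
  simp [Finset.revOn, h]

theorem Finset.revOn_mem (h : v ∈ s) : s.revOn v ∈ s := by
  simp only [Finset.revOn, h, dite_true]
  exact Subtype.property _

theorem Finset.revOn_revOn (s : Finset α) (v : α) : s.revOn (s.revOn v) = v := by
  by_cases h : v ∈ s
  · have h' := Finset.revOn_mem h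
    rw [Finset.revOn, dif_pos h']
    have hval : (s.orderIsoOfFin rfl).symm ⟨s.revOn v, h'⟩ =
        ((s.orderIsoOfFin rfl).symm ⟨v, h⟩).rev := by
      rw [OrderIso.symm_apply_eq]
      ext
      simp [Finset.revOn, h]
    rw [hval, Fin.rev_rev, OrderIso.apply_symm_apply]
  · simp [Finset.revOn_of_notMem h]

theorem Finset.revOn_lt_revOn (hv : v ∈ s) (hw : w ∈ s) (h : v < w) :
    s.revOn w < s.revOn v := by
  simpa [Finset.revOn, hv, hw] using h

end RevOn

/-! ### Forest orders -/

/-- A strict order in which the elements above any given one form a chain. -/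
structure IsForestOrder {α : Type*} (R : α → α → Prop) : Prop where
  irrefl : ∀ a, ¬ R a a
  trans : ∀ {a b c}, R a b → R b c → R a c
  chain : ∀ {a b c}, R a c → R b c → R a b ∨ a = b ∨ R b a

section ForestOrder

variable {α : Type*} [LinearOrder α]

/-- `k` is the topmost strict ancestor of `v` that is smaller than `v`. -/
def TopSmaller (R : α → α → Prop) (k v : α) : Prop :=
  R k v ∧ k < v ∧ ∀ a, R a k → v < a

/-- The vertices with the same topmost smaller ancestor as `v`. -/
noncomputable def topClass [Fintype α] (R : α → α → Prop) (v : α) : Finset α :=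
  open Classical in {w | ∃ k, TopSmaller R k v ∧ TopSmaller R k w}

/-- The relabeling which reverses every class of vertices sharing their topmost smaller
ancestor. -/
noncomputable def twist [Fintype α] (R : α → α → Prop) (v : α) : α :=
  (topClass R v).revOn v

variable {R : α → α → Prop} {k j v w : α}

theorem TopSmaller.unique (hR : IsForestOrder R) (hk : TopSmaller R k v)
    (hj : TopSmaller R j v) : k = j := by
  rcases hR.chain hk.1 hj.1 with h | h | h
  · exact absurd (hj.2.2 _ h) hk.2.1.not_gt
  · exact h
  · exact absurd (hk.2.2 _ h) hj.2.1.not_gt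

theorem TopSmaller.not_topSmaller (hk : TopSmaller R k v) : ¬ TopSmaller R j k :=
  fun hj => absurd (hk.2.2 _ hj.1) (hj.2.1.trans hk.2.1).not_gt

theorem exists_topSmaller [Finite α] (hR : IsForestOrder R) {x : α} (hx : R x v) (hlt : x < v) :
    ∃ k, TopSmaller R k v ∧ (k = x ∨ R k x) := by
  have : IsTrans α R := ⟨fun _ _ _ => hR.trans⟩
  have : Std.Irrefl R := ⟨hR.irrefl⟩
  have wf : WellFounded R := Finite.wellFounded_of_trans_of_irrefl R
  induction x using wf.induction with
  | _ x ih =>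
    by_cases h : ∀ a, R a x → v < a
    · exact ⟨x, ⟨hx, hlt, h⟩, Or.inl rfl⟩
    · push Not at h
      obtain ⟨a, ha, hav⟩ := h
      have hR' := hR.trans ha hx
      have hne : a ≠ v := by
        rintro rfl
        exact hR.irrefl _ hR'
      obtain ⟨k, hk, hka⟩ := ih a ha hR' (lt_of_le_of_ne hav hne)
      refine ⟨k, hk, Or.inr ?_⟩
      rcases hka with rfl | h
      · exact ha
      · exact hR.trans h ha

variable [Fintype α]

theorem mem_topClass (hR : IsForestOrder R) (hk : TopSmaller R k v) :
    w ∈ topClass R v ↔ TopSmaller R k w := by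
  simp only [topClass, Finset.mem_filter, Finset.mem_univ, true_and]
  refine ⟨?_, fun h => ⟨k, hk, h⟩⟩
  rintro ⟨j, hj, hw⟩
  rwa [hk.unique hR hj]

theorem topClass_eq (hR : IsForestOrder R) (hv : TopSmaller R k v) (hw : TopSmaller R k w) :
    topClass R v = topClass R w := by
  ext x
  rw [mem_topClass hR hv, mem_topClass hR hw]

theorem twist_of_forall_not (h : ∀ k, ¬ TopSmaller R k v) : twist R v = v :=
  Finset.revOn_of_notMem (by simp [topClass, h])

theorem TopSmaller.twist_left (hk : TopSmaller R k v) : twist R k = k :=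
  twist_of_forall_not fun _ => hk.not_topSmaller

theorem TopSmaller.twist_right (hR : IsForestOrder R) (hk : TopSmaller R k v) :
    TopSmaller R k (twist R v) :=
  (mem_topClass hR hk).1 (Finset.revOn_mem ((mem_topClass hR hk).2 hk))

theorem twist_twist (hR : IsForestOrder R) (v : α) : twist R (twist R v) = v := by
  by_cases h : ∃ k, TopSmaller R k v
  · obtain ⟨k, hk⟩ := h
    rw [twist, topClass_eq hR (hk.twist_right hR) hk]
    exact Finset.revOn_revOn _ _
  · push Not at h
    rw [twist_of_forall_not h, twist_of_forall_not h]

theorem topSmaller_twist_iff (hR : IsForestOrder R) :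
    TopSmaller R k (twist R v) ↔ TopSmaller R k v :=
  ⟨fun h => by simpa [twist_twist hR] using h.twist_right hR, fun h => h.twist_right hR⟩

theorem twist_lt_twist (hR : IsForestOrder R) (hv : TopSmaller R k v) (hw : TopSmaller R k w)
    (h : v < w) : twist R w < twist R v := by
  rw [twist, twist, topClass_eq hR hw hv]
  exact Finset.revOn_lt_revOn ((mem_topClass hR hv).2 hv) ((mem_topClass hR hv).2 hw) h

/-- The forest order obtained from `R` by relabeling through `twist R`. -/
def twisted (R : α → α → Prop) (a b : α) : Prop :=
  R (twist R a) (twist R b)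

theorem IsForestOrder.twisted (hR : IsForestOrder R) : IsForestOrder (twisted R) where
  irrefl _ := hR.irrefl _
  trans := hR.trans
  chain h h' := by
    have := hR.chain h h'
    rwa [(Function.LeftInverse.injective (twist_twist hR)).eq_iff] at this

theorem TopSmaller.twisted (hR : IsForestOrder R) (hk : TopSmaller R k v) :
    TopSmaller (twisted R) k v := by
  refine ⟨?_, hk.2.1, fun a ha => ?_⟩
  · unfold _root_.twisted
    rw [hk.twist_left]
    exact (hk.twist_right hR).1
  · unfold _root_.twisted at ha
    rw [hk.twist_left] at ha
    by_cases h : ∃ j, TopSmaller R j a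
    · obtain ⟨j, hj⟩ := h
      exact (hk.2.2 j (hR.trans (hj.twist_right hR).1 ha)).trans hj.2.1
    · push Not at h
      rw [twist_of_forall_not h] at ha
      exact hk.2.2 a ha

theorem topSmaller_twisted_iff (hR : IsForestOrder R) :
    TopSmaller (twisted R) k v ↔ TopSmaller R k v := by
  refine ⟨fun h => ?_, fun h => h.twisted hR⟩
  by_cases hv : ∃ j, TopSmaller R j v
  · obtain ⟨j, hj⟩ := hv
    rwa [h.unique hR.twisted (hj.twisted hR)]
  · push Not at hv
    have hmin : ∀ x, R x v → v ≤ x := fun x hx => by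
      by_contra hlt
      obtain ⟨j, hj, -⟩ := exists_topSmaller hR hx (not_le.1 hlt)
      exact hv j hj
    obtain ⟨hkv, hlt, -⟩ := h
    unfold twisted at hkv
    rw [twist_of_forall_not hv] at hkv
    by_cases hk : ∃ j, TopSmaller R j k
    · obtain ⟨j, hj⟩ := hk
      have := hmin j (hR.trans (hj.twist_right hR).1 hkv)
      exact absurd (this.trans_lt (hj.2.1.trans hlt)) (lt_irrefl _)
    · push Not at hk
      rw [twist_of_forall_not hk] at hkv
      exact absurd (hmin k hkv) hlt.not_ge

theorem twist_twisted (hR : IsForestOrder R) : twist (twisted R) = twist R := by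
  have h : topClass (twisted R) = topClass R := by
    funext v
    ext w
    simp only [topClass, topSmaller_twisted_iff hR, Finset.mem_filter]
  funext v
  rw [twist, twist, h]

/-! ### Pattern avoidance and topmost smaller ancestors -/

/-- Conditions on pairs with different topmost smaller ancestors shared by the two avoidance
classes. -/
def CrossFree (R : α → α → Prop) : Prop :=
  (∀ j k y z, TopSmaller R k y → TopSmaller R j z → R y z → ¬ R j k) ∧
  ∀ k i y z, TopSmaller R k y → TopSmaller R i z → R y z → R k i → ¬ R i y

theorem avoids_123_3142_iff (hR : IsForestOrder R) :
    ((∀ x y z, R x y → R y z → x < y → ¬ y < z) ∧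
      ∀ w x y z, R w x → R x y → R y z → x < z → z < w → ¬ w < y) ↔
    (∀ k y z, TopSmaller R k y → TopSmaller R k z → R y z → z < y) ∧ CrossFree R := by
  constructor
  · rintro ⟨h1, h2⟩
    refine ⟨fun k y z hy hz hyz => ?_, fun j k y z hy hz hyz hjk => ?_,
      fun k i y z hy hz hyz hki hiy => ?_⟩
    · refine lt_of_le_of_ne (not_lt.1 (h1 k y z hy.1 hyz hy.2.1)) ?_
      rintro rfl
      exact hR.irrefl _ hyz
    · exact h1 k y z hy.1 hyz hy.2.1 ((hy.2.2 j hjk).trans hz.2.1)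
    · exact h2 k i y z hki hiy hyz hz.2.1 (hz.2.2 k hki) hy.2.1
  · rintro ⟨hA, hB, hC⟩
    have h1 : ∀ x y z, R x y → R y z → x < y → ¬ y < z := by
      intro x y z hxy hyz hx hy
      obtain ⟨k, hk, -⟩ := exists_topSmaller hR hxy hx
      obtain ⟨j, hj, hjk⟩ := exists_topSmaller hR (hR.trans hk.1 hyz) (hk.2.1.trans hy)
      rcases hjk with rfl | hjk
      · exact (hA _ y z hk hj hyz).not_gt hy
      · exact hB j k y z hk hj hyz hjk
    refine ⟨h1, fun w x y z hwx hxy hyz hxz hzw hwy => ?_⟩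
    have hwy' := hR.trans hwx hxy
    obtain ⟨k, hk, hkw⟩ := exists_topSmaller hR hwy' hwy
    rcases lt_trichotomy k z with hkz | rfl | hkz
    · have hkw' : R k w := by
        rcases hkw with rfl | h
        · exact absurd hkz hzw.not_gt
        · exact h
      exact h1 k w y hkw' hwy' (hkz.trans hzw) hwy
    · exact hR.irrefl _ (hR.trans hk.1 hyz)
    · obtain ⟨i, hi, hix⟩ := exists_topSmaller hR (hR.trans hxy hyz) hxz
      have hiy : R i y := by
        rcases hix with rfl | h
        · exact hxy
        · exact hR.trans h hxy
      have hki : R k i := by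
        rcases hR.chain hk.1 hiy with h | rfl | h
        · exact h
        · exact absurd hi.2.1 hkz.not_gt
        · exact absurd (hk.2.2 i h) (hi.2.1.trans (hkz.trans hk.2.1)).not_gt
      exact hC k i y z hk hi hyz hki hiy

theorem avoids_132_3124_iff (hR : IsForestOrder R) :
    ((∀ x y z, R x y → R y z → x < z → ¬ z < y) ∧
      ∀ w x y z, R w x → R x y → R y z → x < y → y < w → ¬ w < z) ↔
    (∀ k y z, TopSmaller R k y → TopSmaller R k z → R y z → y < z) ∧ CrossFree R := by
  constructor
  · rintro ⟨h1, h2⟩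
    refine ⟨fun k y z hy hz hyz => ?_, fun j k y z hy hz hyz hjk => ?_,
      fun k i y z hy hz hyz hki hiy => ?_⟩
    · refine lt_of_le_of_ne (not_lt.1 (h1 k y z hy.1 hyz hz.2.1)) ?_
      rintro rfl
      exact hR.irrefl _ hyz
    · exact h2 j k y z hjk hy.1 hyz hy.2.1 (hy.2.2 j hjk) hz.2.1
    · exact h1 i y z hiy hyz hz.2.1 ((hz.2.2 k hki).trans hy.2.1)
  · rintro ⟨hA, hB, hC⟩
    have h1 : ∀ x y z, R x y → R y z → x < z → ¬ z < y := by
      intro x y z hxy hyz hxz hzy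
      obtain ⟨k, hk, hkx⟩ := exists_topSmaller hR hxy (hxz.trans hzy)
      obtain ⟨i, hi, hix⟩ := exists_topSmaller hR (hR.trans hxy hyz) hxz
      have hiy : R i y := by
        rcases hix with rfl | h
        · exact hxy
        · exact hR.trans h hxy
      rcases hR.chain hk.1 hiy with h | rfl | h
      · exact hC k i y z hk hi hyz h hiy
      · exact (hA _ y z hk hi hyz).not_gt hzy
      · exact absurd (hk.2.2 i h) (hi.2.1.trans hzy).not_gt
    refine ⟨h1, fun w x y z hwx hxy hyz hx hyw hwz => ?_⟩
    obtain ⟨k, hk, -⟩ := exists_topSmaller hR hxy hx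
    obtain ⟨j, hj, hjk⟩ :=
      exists_topSmaller hR (hR.trans hk.1 hyz) (hk.2.1.trans (hyw.trans hwz))
    rcases hjk with rfl | hjk
    · have hwy := hR.trans hwx hxy
      rcases hR.chain hk.1 hwy with h | rfl | h
      · exact h1 _ w y h hwy hk.2.1 hyw
      · exact absurd hk.2.1 hyw.not_gt
      · exact absurd (hj.2.2 w h) hwz.not_gt
    · exact hB j k y z hk hj hyz hjk

theorem CrossFree.twisted (hR : IsForestOrder R) (h : CrossFree R) : CrossFree (twisted R) := by
  refine ⟨fun j k y z hy hz hyz hjk => ?_, fun k i y z hy hz hyz hki hiy => ?_⟩ <;>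
  rw [topSmaller_twisted_iff hR] at hy hz
  · unfold _root_.twisted at hyz hjk
    rw [hy.twist_left, hz.twist_left] at hjk
    exact h.1 j k _ _ (hy.twist_right hR) (hz.twist_right hR) hyz hjk
  · unfold _root_.twisted at hyz hki hiy
    rw [hz.twist_left] at hki hiy
    rw [hy.twist_left] at hki
    exact h.2 k i _ _ (hy.twist_right hR) (hz.twist_right hR) hyz hki hiy

theorem twisted_increasing (hR : IsForestOrder R)
    (h : ∀ k y z, TopSmaller R k y → TopSmaller R k z → R y z → z < y) :
    ∀ k y z, TopSmaller (twisted R) k y → TopSmaller (twisted R) k z → twisted R y z → y < z := by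
  intro k y z hy hz hyz
  rw [topSmaller_twisted_iff hR] at hy hz
  have hy' := hy.twist_right hR
  have hz' := hz.twist_right hR
  simpa only [twist_twist hR] using twist_lt_twist hR hz' hy' (h k _ _ hy' hz' hyz)

theorem twisted_decreasing (hR : IsForestOrder R)
    (h : ∀ k y z, TopSmaller R k y → TopSmaller R k z → R y z → y < z) :
    ∀ k y z, TopSmaller (twisted R) k y → TopSmaller (twisted R) k z → twisted R y z → z < y := by
  intro k y z hy hz hyz
  rw [topSmaller_twisted_iff hR] at hy hz
  have hy' := hy.twist_right hR
  have hz' := hz.twist_right hR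
  simpa only [twist_twist hR] using twist_lt_twist hR hy' hz' (h k _ _ hy' hz' hyz)

end ForestOrder

/-! ### Twisting rooted forests -/

namespace RForest

variable {n : ℕ}

theorem isForestOrder_sAnc (F : RForest n) : IsForestOrder F.SAnc where
  irrefl := F.acyclic
  trans := Relation.TransGen.trans
  chain := by
    intro a b c hac hbc
    have hU : Relator.RightUnique (fun b a => F.parent b = some a) :=
      fun _ _ _ h h' => Option.some.inj (h.symm.trans h')
    have key := Relation.ReflTransGen.total_of_right_unique hU
      (Relation.transGen_swap.2 hac).to_reflTransGen (Relation.transGen_swap.2 hbc).to_reflTransGen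
    rcases key with h | h <;> rcases Relation.reflTransGen_iff_eq_or_transGen.1 h with h | h
    · exact Or.inr (Or.inl h.symm)
    · exact Or.inr (Or.inr (Relation.transGen_swap.1 h))
    · exact Or.inr (Or.inl h)
    · exact Or.inl (Relation.transGen_swap.1 h)

/-- Relabeling a forest along an involution of its labels. -/
def relabel (F : RForest n) (σ : Fin n → Fin n) (hσ : Function.Involutive σ) : RForest n where
  parent v := (F.parent (σ v)).map σ
  acyclic v h := by
    refine F.acyclic (σ v) (Relation.TransGen.lift σ (fun a b hab => ?_) _ _ h)
    obtain ⟨x, hx, rfl⟩ := Option.map_eq_some_iff.1 hab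
    rw [Function.onFun, hx, hσ]

theorem sAnc_relabel (F : RForest n) {σ : Fin n → Fin n} (hσ : Function.Involutive σ)
    (a b : Fin n) : (F.relabel σ hσ).SAnc a b ↔ F.SAnc (σ a) (σ b) := by
  constructor <;> intro h
  · refine Relation.TransGen.lift σ (fun a b hab => ?_) _ _ h
    obtain ⟨x, hx, rfl⟩ := Option.map_eq_some_iff.1 hab
    rw [Function.onFun, hx, hσ]
  · rw [← hσ a, ← hσ b]
    refine Relation.TransGen.lift σ (fun a b hab => ?_) _ _ h
    simp [Function.onFun, relabel, hσ b, hab]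

/-- Reverse the labels in each class of vertices sharing their topmost smaller ancestor. -/
noncomputable def twistForest (F : RForest n) : RForest n :=
  F.relabel (twist F.SAnc) (twist_twist F.isForestOrder_sAnc)

theorem sAnc_twistForest (F : RForest n) : F.twistForest.SAnc = twisted F.SAnc := by
  funext a b
  exact propext (F.sAnc_relabel _ a b)

theorem twistForest_involutive : Function.Involutive (twistForest (n := n)) := by
  intro F
  have key : F.twistForest.twistForest.parent = F.parent := by
    funext v
    have hσ : twist F.twistForest.SAnc = twist F.SAnc := by
      rw [sAnc_twistForest, twist_twisted F.isForestOrder_sAnc]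
    change (F.twistForest.parent (twist F.twistForest.SAnc v)).map (twist F.twistForest.SAnc) = _
    rw [hσ]
    change ((F.parent (twist F.SAnc (twist F.SAnc v))).map (twist F.SAnc)).map (twist F.SAnc) = _
    rw [twist_twist F.isForestOrder_sAnc, Option.map_map,
      show twist F.SAnc ∘ twist F.SAnc = id from funext (twist_twist F.isForestOrder_sAnc), Option.map_id, id]
  generalize F.twistForest.twistForest = G at key
  cases F
  cases G
  congr

end RForest

/-! ### The two avoidance classes -/

section Patterns

variable {n : ℕ} (F : RForest n)

theorem not_containsPat_p123_iff :
    ¬ ContainsPat F p123 ↔ ∀ x y z, F.SAnc x y → F.SAnc y z → x < y → ¬ y < z := by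
  constructor
  · intro h x y z hxy hyz h1 h2
    refine h ⟨![x, y, z], ?_, ?_⟩
    · have := hxy.trans hyz
      simp_all [Fin.forall_fin_succ, RForest.SAnc]
    · simp [Fin.forall_fin_succ, p123]
      split_ands <;> order
  · rintro h ⟨v, h1, h2⟩
    exact h (v 0) (v 1) (v 2) (h1 _ _ (by decide)) (h1 _ _ (by decide))
      ((h2 _ _).2 (by decide)) ((h2 _ _).2 (by decide))

theorem not_containsPat_p132_iff :
    ¬ ContainsPat F p132 ↔ ∀ x y z, F.SAnc x y → F.SAnc y z → x < z → ¬ z < y := by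
  constructor
  · intro h x y z hxy hyz h1 h2
    refine h ⟨![x, y, z], ?_, ?_⟩
    · have := hxy.trans hyz
      simp_all [Fin.forall_fin_succ, RForest.SAnc]
    · simp [Fin.forall_fin_succ, p132]
      split_ands <;> order
  · rintro h ⟨v, h1, h2⟩
    exact h (v 0) (v 1) (v 2) (h1 _ _ (by decide)) (h1 _ _ (by decide))
      ((h2 _ _).2 (by decide)) ((h2 _ _).2 (by decide))

theorem not_containsPat_p3142_iff :
    ¬ ContainsPat F p3142 ↔
      ∀ w x y z, F.SAnc w x → F.SAnc x y → F.SAnc y z → x < z → z < w → ¬ w < y := by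
  constructor
  · intro h w x y z hwx hxy hyz h1 h2 h3
    refine h ⟨![w, x, y, z], ?_, ?_⟩
    · have := hwx.trans hxy
      have := hxy.trans hyz
      have := hwx.trans this
      simp_all [Fin.forall_fin_succ, RForest.SAnc]
    · simp [Fin.forall_fin_succ, p3142]
      split_ands <;> order
  · rintro h ⟨v, h1, h2⟩
    exact h (v 0) (v 1) (v 2) (v 3) (h1 _ _ (by decide)) (h1 _ _ (by decide))
      (h1 _ _ (by decide)) ((h2 _ _).2 (by decide)) ((h2 _ _).2 (by decide))
      ((h2 _ _).2 (by decide))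

theorem not_containsPat_p3124_iff :
    ¬ ContainsPat F p3124 ↔
      ∀ w x y z, F.SAnc w x → F.SAnc x y → F.SAnc y z → x < y → y < w → ¬ w < z := by
  constructor
  · intro h w x y z hwx hxy hyz h1 h2 h3
    refine h ⟨![w, x, y, z], ?_, ?_⟩
    · have := hwx.trans hxy
      have := hxy.trans hyz
      have := hwx.trans this
      simp_all [Fin.forall_fin_succ, RForest.SAnc]
    · simp [Fin.forall_fin_succ, p3124]
      split_ands <;> order
  · rintro h ⟨v, h1, h2⟩
    exact h (v 0) (v 1) (v 2) (v 3) (h1 _ _ (by decide)) (h1 _ _ (by decide))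
      (h1 _ _ (by decide)) ((h2 _ _).2 (by decide)) ((h2 _ _).2 (by decide))
      ((h2 _ _).2 (by decide))

theorem avoids_twistForest_iff :
    (¬ ContainsPat F p123 ∧ ¬ ContainsPat F p3142) ↔
      ¬ ContainsPat F.twistForest p132 ∧ ¬ ContainsPat F.twistForest p3124 := by
  rw [not_containsPat_p123_iff, not_containsPat_p3142_iff, not_containsPat_p132_iff,
    not_containsPat_p3124_iff, avoids_123_3142_iff F.isForestOrder_sAnc,
    avoids_132_3124_iff F.twistForest.isForestOrder_sAnc]
  constructor
  · rintro ⟨hA, hC⟩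
    rw [F.sAnc_twistForest]
    exact ⟨twisted_increasing F.isForestOrder_sAnc hA, hC.twisted F.isForestOrder_sAnc⟩
  · rintro ⟨hA, hC⟩
    have hF := F.twistForest.isForestOrder_sAnc
    have := And.intro (twisted_decreasing hF hA) (hC.twisted hF)
    rwa [← RForest.sAnc_twistForest, RForest.twistForest_involutive F] at this

end Patterns

/-- The sets `{123, 3142}` and `{132, 3124}` are forest-Wilf equivalent. -/
theorem forestWilf_123_3142_eq_132_3124 :
    ∀ n : ℕ,
      Nat.card {F : RForest n // ¬ ContainsPat F p123 ∧ ¬ ContainsPat F p3142} =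
      Nat.card {F : RForest n // ¬ ContainsPat F p132 ∧ ¬ ContainsPat F p3124} := by
  exact fun n => Nat.card_congr
    (RForest.twistForest_involutive.toPerm.subtypeEquiv avoids_twistForest_iff)
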